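/- For every real M ≥ 1, adjusted homophily violates monotonicity in the following concrete instance on 4 classes {0,1,2,3}: for the class adjacency matrix c with c 2 3 = c 3 2 = M, c 3 3 = 2, and all other entries 0, one has h_adj(c) = −M/(M + 2); for the matrix c' obtained from c by additionally setting c' 0 1 = c' 1 0 = 1 (adding one inter-class edge), one has h_adj(c') = (1 − M)/(M + 5); and h_adj(c') > h_adj(c), i.e., adding an inter-class edge strictly increases adjusted homophily. -/

import Mathlib

open Finset

/-- **Counterexample to monotonicity of adjusted homophily for small values.**
For every real `M ≥ 1`, on 4 classes with class adjacency matrix `c` having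
`c 2 3 = c 3 2 = M`, `c 3 3 = 2` and all other entries `0`, one has
`h_adj(c) = −M/(M+2)`; after additionally adding one inter-class edge between
classes `0` and `1` (i.e. `c' 0 1 = c' 1 0 = 1`), one has
`h_adj(c') = (1 − M)/(M + 5)`, and `h_adj(c') > h_adj(c)`. -/
theorem adjusted_homophily_not_monotone_counterexample (M : ℝ) (hM : 1 ≤ M) :
    let c : Fin 4 → Fin 4 → ℝ := fun i j =>
      if (i = 2 ∧ j = 3) ∨ (i = 3 ∧ j = 2) then M else if i = 3 ∧ j = 3 then 2 else 0
    let c' : Fin 4 → Fin 4 → ℝ := fun i j =>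
      if (i = 0 ∧ j = 1) ∨ (i = 1 ∧ j = 0) then 1 else c i j
    let hadj : (Fin 4 → Fin 4 → ℝ) → ℝ := fun m =>
      ((∑ i, ∑ j, m i j) * (∑ i, m i i) - ∑ i, (∑ j, m i j) ^ 2) /
        ((∑ i, ∑ j, m i j) ^ 2 - ∑ i, (∑ j, m i j) ^ 2)
    hadj c = -M / (M + 2) ∧
    hadj c' = (1 - M) / (M + 5) ∧
    hadj c < hadj c' := by
  intro c c' hadj
  have h : hadj c = -M / (M + 2) := by
    simp only [hadj, c, Fin.sum_univ_four]
    simp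
    rw [div_eq_div_iff (by nlinarith) (by linarith)]
    ring
  have h' : hadj c' = (1 - M) / (M + 5) := by
    simp only [hadj, c', c, Fin.sum_univ_four]
    simp
    rw [div_eq_div_iff (by nlinarith) (by linarith)]
    ring
  refine ⟨h, h', ?_⟩
  rw [h, h', div_lt_div_iff₀ (by linarith) (by linarith)]
  linarith
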